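/- arXiv:1208.6280 — 4 statements merged into one kernel-verified Lean document; each statement's English description precedes it below -/
import Mathlib

section
/- (Lemma 6.1) Assume F is an infinite field and let X ∈ 𝒩 be an element of the nilpotent cone. Then the following are equivalent: (1) X is regular; (2) there exists h ∈ GL_n(F) such that h·X = ξ_+ or h·X = ξ_−; (3) Δ_+(X) ≠ 0 or Δ_−(X) ≠ 0. -/
open Matrix MeasureTheory

namespace ZhangRTF

variable {F : Type*} [Field F] {n : ℕ}

/-- Block diagonal embedding `diag(h,1) ∈ M_{n+1}(F)` of `h ∈ M_n(F)`. -/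
def emb (h : Matrix (Fin n) (Fin n) F) : Matrix (Fin (n + 1)) (Fin (n + 1)) F :=
  Matrix.of fun i j =>
    if hi : (i : ℕ) < n then
      (if hj : (j : ℕ) < n then h ⟨i, hi⟩ ⟨j, hj⟩ else 0)
    else (if (j : ℕ) < n then 0 else 1)

/-- Conjugation action of `GL_n(F)` on `M_{n+1}(F)`: `h·X = diag(h,1) X diag(h,1)⁻¹`. -/
def act (h : Matrix.GeneralLinearGroup (Fin n) F)
    (X : Matrix (Fin (n + 1)) (Fin (n + 1)) F) : Matrix (Fin (n + 1)) (Fin (n + 1)) F :=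
  emb (h : Matrix (Fin n) (Fin n) F) * X *
    emb ((h⁻¹ : Matrix.GeneralLinearGroup (Fin n) F) : Matrix (Fin n) (Fin n) F)

/-- The upper-left `n × n` block `A` of `X = [[A,u],[v,w]]`. -/
def blockA (X : Matrix (Fin (n + 1)) (Fin (n + 1)) F) : Matrix (Fin n) (Fin n) F :=
  Matrix.of fun i j => X i.castSucc j.castSucc

/-- The upper-right column `u` of `X = [[A,u],[v,w]]`. -/
def blockU (X : Matrix (Fin (n + 1)) (Fin (n + 1)) F) : Fin n → F :=
  fun i => X i.castSucc (Fin.last n)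

/-- The lower-left row `v` of `X = [[A,u],[v,w]]`. -/
def blockV (X : Matrix (Fin (n + 1)) (Fin (n + 1)) F) : Fin n → F :=
  fun j => X (Fin.last n) j.castSucc

/-- The lower-right corner `w` of `X = [[A,u],[v,w]]`. -/
def blockW (X : Matrix (Fin (n + 1)) (Fin (n + 1)) F) : F :=
  X (Fin.last n) (Fin.last n)

/-- `δ₊(X)`: the matrix whose `j`-th column is `A^{n-j} u` (`1 ≤ j ≤ n`, 1-indexed). -/
def deltaPlus (X : Matrix (Fin (n + 1)) (Fin (n + 1)) F) : Matrix (Fin n) (Fin n) F :=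
  Matrix.of fun i j => (blockA X ^ (n - 1 - (j : ℕ)) *ᵥ blockU X) i

/-- `δ₋(X)`: the matrix whose `i`-th row is `v A^{i-1}` (`1 ≤ i ≤ n`, 1-indexed). -/
def deltaMinus (X : Matrix (Fin (n + 1)) (Fin (n + 1)) F) : Matrix (Fin n) (Fin n) F :=
  Matrix.of fun i j => (blockV X ᵥ* blockA X ^ (i : ℕ)) j

/-- `Δ₊(X) = det δ₊(X)`. -/
def DeltaPlus (X : Matrix (Fin (n + 1)) (Fin (n + 1)) F) : F := (deltaPlus X).det

/-- `Δ₋(X) = det δ₋(X)`. -/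
def DeltaMinus (X : Matrix (Fin (n + 1)) (Fin (n + 1)) F) : F := (deltaMinus X).det

/-- The `a`-invariants: `a_i = -(coefficient of T^{n-i} in charpoly A)` (1-indexed). -/
noncomputable def aInv (X : Matrix (Fin (n + 1)) (Fin (n + 1)) F) : Fin n → F :=
  fun i => -((blockA X).charpoly.coeff (n - 1 - (i : ℕ)))

/-- The `b`-invariants: `b_0 = w` and `b_j = v A^{j-1} u` for `1 ≤ j ≤ n`. -/
def bInv (X : Matrix (Fin (n + 1)) (Fin (n + 1)) F) : Fin (n + 1) → F :=
  fun j => if (j : ℕ) = 0 then blockW X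
    else blockV X ⬝ᵥ (blockA X ^ ((j : ℕ) - 1) *ᵥ blockU X)

/-- The invariants map `π : M_{n+1}(F) → F^n × F^{n+1}`. -/
noncomputable def invMap (X : Matrix (Fin (n + 1)) (Fin (n + 1)) F) : (Fin n → F) × (Fin (n + 1) → F) :=
  (aInv X, bInv X)

/-- The regular nilpotent `ξ₊`: `(i,i+1)`-entries equal to `1`, all others `0`. -/
def xiPlus (n : ℕ) : Matrix (Fin (n + 1)) (Fin (n + 1)) F :=
  Matrix.of fun i j => if (j : ℕ) = (i : ℕ) + 1 then 1 else 0

/-- The section `σ(a,b)` of the invariants map. -/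
def sectSigma (a : Fin n → F) (b : Fin (n + 1) → F) : Matrix (Fin (n + 1)) (Fin (n + 1)) F :=
  Matrix.of fun i j =>
    if hi : (i : ℕ) < n then
      (if (j : ℕ) = 0 then a ⟨i, hi⟩ else 0) + (if (j : ℕ) = (i : ℕ) + 1 then 1 else 0)
    else b j.rev

/-- The variant section `σ'(a,b)`. -/
def sectSigma' (a : Fin n → F) (b : Fin (n + 1) → F) : Matrix (Fin (n + 1)) (Fin (n + 1)) F :=
  Matrix.of fun i j =>
    if (i : ℕ) < n - 1 then (if (j : ℕ) = (i : ℕ) + 1 then 1 else 0)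
    else if (i : ℕ) = n - 1 then
      (if hj : (j : ℕ) < n then a ⟨n - 1 - (j : ℕ), by omega⟩ else 1)
    else b j.rev

/-- Membership in `N_{n,-}`: lower triangular with unit diagonal. -/
def IsLowerUni (h : Matrix (Fin n) (Fin n) F) : Prop :=
  (∀ i, h i i = 1) ∧ ∀ i j : Fin n, i < j → h i j = 0

/-- Membership in `N_n`: upper triangular with unit diagonal. -/
def IsUpperUni (h : Matrix (Fin n) (Fin n) F) : Prop :=
  (∀ i, h i i = 1) ∧ ∀ i j : Fin n, j < i → h i j = 0

/-- Membership in the subvariety `𝒲`: superdiagonal entries `1`,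
entries above the superdiagonal `0`. -/
def memW (X : Matrix (Fin (n + 1)) (Fin (n + 1)) F) : Prop :=
  ∀ i j : Fin (n + 1),
    ((j : ℕ) = (i : ℕ) + 1 → X i j = 1) ∧ ((i : ℕ) + 1 < (j : ℕ) → X i j = 0)

/-- `p : 𝒲 → 𝒱`, replacing the last row by zero. -/
def pMap (X : Matrix (Fin (n + 1)) (Fin (n + 1)) F) : Matrix (Fin (n + 1)) (Fin (n + 1)) F :=
  Matrix.of fun i j => if (i : ℕ) = n then 0 else X i j

/-- `p' : 𝒲 → 𝒱'`, replacing the last row and the first column by zero. -/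
def pMap' (X : Matrix (Fin (n + 1)) (Fin (n + 1)) F) : Matrix (Fin (n + 1)) (Fin (n + 1)) F :=
  Matrix.of fun i j => if (i : ℕ) = n ∨ (j : ℕ) = 0 then 0 else X i j

/-- The determinant of an element of `GL_n(F)`, as a unit of `F`. -/
def GLdet (h : Matrix.GeneralLinearGroup (Fin n) F) : Fˣ :=
  Units.map Matrix.detMonoidHom h

end ZhangRTF

open ZhangRTF

namespace ZhangRTF

section helpers

variable {F : Type*} [Field F] {n : ℕ}

lemma emb_cc (h : Matrix (Fin n) (Fin n) F) (i j : Fin n) :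
    emb h i.castSucc j.castSucc = h i j := by simp [emb]
lemma emb_cl (h : Matrix (Fin n) (Fin n) F) (i : Fin n) :
    emb h i.castSucc (Fin.last n) = 0 := by simp [emb]
lemma emb_lc (h : Matrix (Fin n) (Fin n) F) (j : Fin n) :
    emb h (Fin.last n) j.castSucc = 0 := by simp [emb]
lemma emb_ll (h : Matrix (Fin n) (Fin n) F) :
    emb h (Fin.last n) (Fin.last n) = 1 := by simp [emb]

lemma emb_mul (g h : Matrix (Fin n) (Fin n) F) : emb g * emb h = emb (g * h) := by
  ext i j
  refine Fin.lastCases ?_ (fun i => ?_) i <;> refine Fin.lastCases ?_ (fun j => ?_) j <;>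
    simp [Matrix.mul_apply, Fin.sum_univ_castSucc, emb_cc, emb_cl, emb_lc, emb_ll]

lemma emb_one : emb (1 : Matrix (Fin n) (Fin n) F) = 1 := by
  ext i j
  refine Fin.lastCases ?_ (fun i => ?_) i <;> refine Fin.lastCases ?_ (fun j => ?_) j <;>
    simp [emb_cc, emb_cl, emb_lc, emb_ll, Matrix.one_apply, Fin.ext_iff]
  all_goals omega

lemma emb_transpose (h : Matrix (Fin n) (Fin n) F) : (emb h)ᵀ = emb hᵀ := by
  ext i j
  refine Fin.lastCases ?_ (fun i => ?_) i <;> refine Fin.lastCases ?_ (fun j => ?_) j <;>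
    simp [emb_cc, emb_cl, emb_lc, emb_ll]

lemma emb_inv_mul (h : GeneralLinearGroup (Fin n) F) :
    emb ((h⁻¹ : GeneralLinearGroup (Fin n) F) : Matrix (Fin n) (Fin n) F) *
      emb (h : Matrix (Fin n) (Fin n) F) = 1 := by
  rw [emb_mul, ← Units.val_mul, inv_mul_cancel, Units.val_one, emb_one]

lemma emb_mul_inv (h : GeneralLinearGroup (Fin n) F) :
    emb (h : Matrix (Fin n) (Fin n) F) *
      emb ((h⁻¹ : GeneralLinearGroup (Fin n) F) : Matrix (Fin n) (Fin n) F) = 1 := by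
  rw [emb_mul, ← Units.val_mul, mul_inv_cancel, Units.val_one, emb_one]

lemma act_eq_iff (h : GeneralLinearGroup (Fin n) F)
    (X Y : Matrix (Fin (n + 1)) (Fin (n + 1)) F) :
    act h X = Y ↔ emb (h : Matrix (Fin n) (Fin n) F) * X
      = Y * emb (h : Matrix (Fin n) (Fin n) F) := by
  unfold act
  constructor
  · rintro rfl
    rw [Matrix.mul_assoc, emb_inv_mul, Matrix.mul_one]
  · intro e
    rw [e, Matrix.mul_assoc, emb_mul_inv, Matrix.mul_one]

lemma act_eq_iff' (h : GeneralLinearGroup (Fin n) F)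
    (X Y : Matrix (Fin (n + 1)) (Fin (n + 1)) F) :
    act h X = Y ↔
      X * emb ((h⁻¹ : GeneralLinearGroup (Fin n) F) : Matrix (Fin n) (Fin n) F) =
      emb ((h⁻¹ : GeneralLinearGroup (Fin n) F) : Matrix (Fin n) (Fin n) F) * Y := by
  unfold act
  constructor
  · rintro rfl
    rw [Matrix.mul_assoc, ← Matrix.mul_assoc, emb_inv_mul, Matrix.one_mul]
  · intro e
    rw [Matrix.mul_assoc, e, ← Matrix.mul_assoc, emb_mul_inv, Matrix.one_mul]

/-- Stabilizer equation in blocks. -/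
lemma stab_iff (h : GeneralLinearGroup (Fin n) F)
    (X : Matrix (Fin (n + 1)) (Fin (n + 1)) F) :
    act h X = X ↔ ((h : Matrix (Fin n) (Fin n) F) * blockA X = blockA X * h ∧
      (h : Matrix (Fin n) (Fin n) F) *ᵥ blockU X = blockU X ∧
      blockV X ᵥ* (h : Matrix (Fin n) (Fin n) F) = blockV X) := by
  rw [act_eq_iff]
  constructor
  · intro e
    refine ⟨?_, ?_, ?_⟩
    · ext i j
      have := congrFun (congrFun e i.castSucc) j.castSucc
      simpa [Matrix.mul_apply, Fin.sum_univ_castSucc, emb_cc, emb_cl, emb_lc, emb_ll, blockA]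
        using this
    · ext i
      have := congrFun (congrFun e i.castSucc) (Fin.last n)
      simpa [Matrix.mul_apply, Fin.sum_univ_castSucc, emb_cc, emb_cl, emb_lc, emb_ll, blockU,
        Matrix.mulVec, dotProduct] using this
    · ext j
      have := congrFun (congrFun e (Fin.last n)) j.castSucc
      simpa [Matrix.mul_apply, Fin.sum_univ_castSucc, emb_cc, emb_cl, emb_lc, emb_ll, blockV,
        Matrix.vecMul, dotProduct] using this.symm
  · rintro ⟨e1, e2, e3⟩
    ext i j
    refine Fin.lastCases ?_ (fun i => ?_) i <;> refine Fin.lastCases ?_ (fun j => ?_) j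
    · simp [Matrix.mul_apply, Fin.sum_univ_castSucc, emb_cl, emb_lc, emb_ll]
    · have := congrFun e3 j
      simpa [Matrix.mul_apply, Fin.sum_univ_castSucc, emb_cc, emb_cl, emb_lc, emb_ll, blockV,
        Matrix.vecMul, dotProduct] using this.symm
    · have := congrFun e2 i
      simpa [Matrix.mul_apply, Fin.sum_univ_castSucc, emb_cc, emb_cl, emb_lc, emb_ll, blockU,
        Matrix.mulVec, dotProduct] using this
    · have := congrFun (congrFun e1 i) j
      simpa [Matrix.mul_apply, Fin.sum_univ_castSucc, emb_cc, emb_cl, emb_lc, emb_ll, blockA]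
        using this

lemma pow_blockA_eq_zero {X : Matrix (Fin (n + 1)) (Fin (n + 1)) F} (hX : invMap X = 0) :
    blockA X ^ n = 0 := by
  have ha : aInv X = 0 := congrArg Prod.fst hX
  have hc : (blockA X).charpoly = Polynomial.X ^ n := by
    ext k
    rw [Polynomial.coeff_X_pow]
    rcases lt_trichotomy k n with hk | hk | hk
    · have := congrFun ha ⟨n - 1 - k, by omega⟩
      have e : n - 1 - (n - 1 - k) = k := by omega
      simp only [aInv, e, Pi.zero_apply, neg_eq_zero] at this
      rw [this, if_neg (by omega)]
    · subst hk
      have h1 := Matrix.charpoly_monic (blockA X)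
      have h2 : (blockA X).charpoly.natDegree = k := by simp
      rw [if_pos rfl]
      unfold Polynomial.Monic Polynomial.leadingCoeff at h1
      rwa [h2] at h1
    · rw [if_neg (by omega)]
      apply Polynomial.coeff_eq_zero_of_natDegree_lt
      simpa using hk
  have := Matrix.aeval_self_charpoly (blockA X)
  rwa [hc, map_pow, Polynomial.aeval_X] at this

lemma w_eq_zero {X : Matrix (Fin (n + 1)) (Fin (n + 1)) F} (hX : invMap X = 0) :
    X (Fin.last n) (Fin.last n) = 0 := by
  have hb : bInv X = 0 := congrArg Prod.snd hX
  simpa [bInv, blockW] using congrFun hb 0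

lemma vAu {X : Matrix (Fin (n + 1)) (Fin (n + 1)) F} (hX : invMap X = 0) (k : ℕ) (hk : k < n) :
    blockV X ⬝ᵥ (blockA X ^ k *ᵥ blockU X) = 0 := by
  have hb : bInv X = 0 := congrArg Prod.snd hX
  simpa [bInv] using congrFun hb ⟨k + 1, by omega⟩

lemma blockA_transpose (X : Matrix (Fin (n + 1)) (Fin (n + 1)) F) :
    blockA Xᵀ = (blockA X)ᵀ := rfl
lemma blockU_transpose (X : Matrix (Fin (n + 1)) (Fin (n + 1)) F) :
    blockU Xᵀ = blockV X := rfl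
lemma blockV_transpose (X : Matrix (Fin (n + 1)) (Fin (n + 1)) F) :
    blockV Xᵀ = blockU X := rfl

lemma invMap_transpose {X : Matrix (Fin (n + 1)) (Fin (n + 1)) F} (hX : invMap X = 0) :
    invMap Xᵀ = 0 := by
  rw [← hX]
  unfold invMap
  congr 1
  · ext i
    simp [aInv, blockA_transpose, Matrix.charpoly_transpose]
  · ext j
    have hw : blockW Xᵀ = blockW X := rfl
    simp only [bInv, blockA_transpose, blockU_transpose, blockV_transpose, hw]
    split_ifs
    · rfl
    · rw [← Matrix.transpose_pow, Matrix.mulVec_transpose, dotProduct_comm,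
        Matrix.dotProduct_mulVec]

lemma deltaPlus_transpose (X : Matrix (Fin (n + 1)) (Fin (n + 1)) F) :
    deltaPlus Xᵀ = (deltaMinus X)ᵀ.submatrix id Fin.revPerm := by
  ext i j
  have e : n - (j.val + 1) = n - 1 - j.val := by omega
  simp [deltaPlus, deltaMinus, blockA_transpose, blockU_transpose, ← Matrix.transpose_pow,
    Matrix.mulVec_transpose, Fin.val_rev, e]

lemma DeltaPlus_transpose (X : Matrix (Fin (n + 1)) (Fin (n + 1)) F) :
    DeltaPlus Xᵀ ≠ 0 ↔ DeltaMinus X ≠ 0 := by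
  unfold DeltaPlus DeltaMinus
  rw [deltaPlus_transpose, Matrix.det_permute', Matrix.det_transpose]
  rcases Int.units_eq_one_or (Equiv.Perm.sign (Fin.revPerm : Equiv.Perm (Fin n))) with h | h <;>
    simp [h]

/-- Last nonzero iterate. -/
lemma exists_last (A : Matrix (Fin n) (Fin n) F) (hA : A ^ n = 0) (x : Fin n → F) (hx : x ≠ 0) :
    ∃ m, m < n ∧ A ^ m *ᵥ x ≠ 0 ∧ A *ᵥ (A ^ m *ᵥ x) = 0 := by
  classical
  have hex : ∃ m, A ^ m *ᵥ x = 0 := ⟨n, by simp [hA]⟩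
  have h0 : Nat.find hex ≠ 0 := by
    intro h
    have := Nat.find_spec hex
    rw [h] at this
    simp at this
    exact hx this
  have hle : Nat.find hex ≤ n := Nat.find_min' hex (by simp [hA])
  refine ⟨Nat.find hex - 1, by omega, Nat.find_min hex (by omega), ?_⟩
  rw [Matrix.mulVec_mulVec, ← pow_succ']
  have e : Nat.find hex - 1 + 1 = Nat.find hex := by omega
  rw [e]
  exact Nat.find_spec hex

lemma exists_ker {X : Matrix (Fin (n + 1)) (Fin (n + 1)) F} (hX : invMap X = 0)
    (hD : DeltaMinus X = 0) :
    ∃ k : Fin n → F, k ≠ 0 ∧ blockA X *ᵥ k = 0 ∧ blockV X ⬝ᵥ k = 0 := by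
  obtain ⟨x, hx, hx0⟩ := Matrix.exists_mulVec_eq_zero_iff.mpr hD
  obtain ⟨m, hm, h1, h2⟩ := exists_last _ (pow_blockA_eq_zero hX) x hx
  refine ⟨_, h1, h2, ?_⟩
  have := congrFun hx0 ⟨m, hm⟩
  rw [Matrix.dotProduct_mulVec]
  exact this

lemma regular_imp [Infinite F] {X : Matrix (Fin (n + 1)) (Fin (n + 1)) F} (hX : invMap X = 0)
    (hreg : ∀ h : GeneralLinearGroup (Fin n) F, act h X = X → h = 1) :
    DeltaPlus X ≠ 0 ∨ DeltaMinus X ≠ 0 := by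
  classical
  by_contra hcon
  push Not at hcon
  obtain ⟨hp, hm⟩ := hcon
  obtain ⟨k, hk, hAk, hvk⟩ := exists_ker hX hm
  have hm' : DeltaMinus Xᵀ = 0 := by
    by_contra h
    exact (DeltaPlus_transpose Xᵀ).mpr h (by rwa [Matrix.transpose_transpose])
  obtain ⟨f, hf, hAf, huf⟩ := exists_ker (invMap_transpose hX) hm'
  rw [blockA_transpose, Matrix.mulVec_transpose] at hAf
  rw [blockV_transpose] at huf
  obtain ⟨t, ht⟩ := Infinite.exists_notMem_finset ({0, -(f ⬝ᵥ k)⁻¹} : Finset F)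
  simp only [Finset.mem_insert, Finset.mem_singleton, not_or] at ht
  obtain ⟨ht0, ht1⟩ := ht
  have hdet : (1 + t • Matrix.vecMulVec k f).det ≠ 0 := by
    have : t • Matrix.vecMulVec k f = Matrix.replicateCol Unit (t • k) * Matrix.replicateRow Unit f := by
      ext i j
      simp [Matrix.vecMulVec_apply, Matrix.mul_apply, mul_assoc]
    rw [this, Matrix.det_one_add_replicateCol_mul_replicateRow, dotProduct_smul, smul_eq_mul]
    intro h
    have hc : f ⬝ᵥ k ≠ 0 := by
      intro h0
      simp [h0] at h
    apply ht1
    field_simp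
    linear_combination h
  set h : GeneralLinearGroup (Fin n) F := Matrix.GeneralLinearGroup.mkOfDetNeZero _ hdet with hh
  have hval : (h : Matrix (Fin n) (Fin n) F) = 1 + t • Matrix.vecMulVec k f := rfl
  have h1 := hreg h (by
    rw [stab_iff, hval]
    refine ⟨?_, ?_, ?_⟩
    · simp [Matrix.add_mul, Matrix.mul_add, Matrix.vecMulVec_mul, Matrix.mul_vecMulVec, hAk, hAf]
    · rw [dotProduct_comm] at huf
      simp [Matrix.add_mulVec, Matrix.smul_mulVec, Matrix.vecMulVec_mulVec, huf]
    · simp [Matrix.vecMul_add, Matrix.vecMul_smul, Matrix.vecMul_vecMulVec, hvk])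
  rw [h1, Units.val_one, left_eq_add, smul_eq_zero] at hval
  obtain ⟨i, hi⟩ := Function.ne_iff.mp hk
  obtain ⟨j, hj⟩ := Function.ne_iff.mp hf
  rcases hval with h | h
  · exact ht0 h
  · have := congrFun (congrFun h i) j
    simp only [Matrix.vecMulVec_apply, Matrix.zero_apply, mul_eq_zero] at this
    exact this.elim hi hj

lemma imp_regular {X : Matrix (Fin (n + 1)) (Fin (n + 1)) F}
    (hD : DeltaPlus X ≠ 0 ∨ DeltaMinus X ≠ 0)
    (h : GeneralLinearGroup (Fin n) F) (hs : act h X = X) : h = 1 := by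
  obtain ⟨e1, e2, e3⟩ := (stab_iff h X).mp hs
  have hc : Commute (h : Matrix (Fin n) (Fin n) F) (blockA X) := e1
  apply Units.ext
  rw [Units.val_one]
  rcases hD with hD | hD
  · have : (h : Matrix (Fin n) (Fin n) F) * deltaPlus X = 1 * deltaPlus X := by
      ext i j
      have e : ((h : Matrix (Fin n) (Fin n) F) * deltaPlus X) i j =
        ((h : Matrix (Fin n) (Fin n) F) *ᵥ
          (blockA X ^ (n - 1 - (j : ℕ)) *ᵥ blockU X)) i := rfl
      rw [e, Matrix.mulVec_mulVec, (hc.pow_right _).eq, ← Matrix.mulVec_mulVec, e2, Matrix.one_mul]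
      rfl
    have hu : IsUnit (deltaPlus X) := (Matrix.isUnit_iff_isUnit_det _).mpr hD.isUnit
    exact hu.mul_right_cancel this
  · have : deltaMinus X * (h : Matrix (Fin n) (Fin n) F) = deltaMinus X * 1 := by
      ext i j
      have e : (deltaMinus X * (h : Matrix (Fin n) (Fin n) F)) i j =
        ((blockV X ᵥ* blockA X ^ (i : ℕ)) ᵥ* (h : Matrix (Fin n) (Fin n) F)) j := rfl
      rw [e, Matrix.vecMul_vecMul, ← (hc.pow_right _).eq, ← Matrix.vecMul_vecMul, e3,
        Matrix.mul_one]
      rfl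
    have hu : IsUnit (deltaMinus X) := (Matrix.isUnit_iff_isUnit_det _).mpr hD.isUnit
    exact hu.mul_left_cancel this

lemma mul_xiPlus_zero (Z : Matrix (Fin (n + 1)) (Fin (n + 1)) F) (i : Fin (n + 1)) :
    (Z * (xiPlus n : Matrix (Fin (n + 1)) (Fin (n + 1)) F)) i 0 = 0 := by
  simp [Matrix.mul_apply, xiPlus]

lemma mul_xiPlus_succ (Z : Matrix (Fin (n + 1)) (Fin (n + 1)) F) (i : Fin (n + 1)) (j : Fin n) :
    (Z * (xiPlus n : Matrix (Fin (n + 1)) (Fin (n + 1)) F)) i j.succ = Z i j.castSucc := by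
  rw [Matrix.mul_apply, Finset.sum_eq_single j.castSucc]
  · simp [xiPlus]
  · intro b _ hb
    have : ¬ ((j : ℕ) = b) := fun h => hb (Fin.ext h.symm)
    simp [xiPlus, this]
  · simp

lemma plus_imp_xi (hn : 1 ≤ n) {X : Matrix (Fin (n + 1)) (Fin (n + 1)) F} (hX : invMap X = 0)
    (hD : DeltaPlus X ≠ 0) :
    ∃ h : GeneralLinearGroup (Fin n) F, act h X = xiPlus n := by
  refine ⟨(Matrix.GeneralLinearGroup.mkOfDetNeZero _ hD)⁻¹, ?_⟩
  rw [act_eq_iff', inv_inv]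
  change X * emb (deltaPlus X) = emb (deltaPlus X) * xiPlus n
  have key : ∀ i j : Fin n, (blockA X * deltaPlus X) i j =
      (blockA X ^ (n - 1 - (j : ℕ) + 1) *ᵥ blockU X) i := by
    intro i j
    have e : (blockA X * deltaPlus X) i j =
      (blockA X *ᵥ (blockA X ^ (n - 1 - (j : ℕ)) *ᵥ blockU X)) i := rfl
    rw [e, Matrix.mulVec_mulVec, ← pow_succ']
  have hv : ∀ j : Fin n, (X * emb (deltaPlus X)) (Fin.last n) j.castSucc = 0 := by
    intro j
    have := vAu hX (n - 1 - (j : ℕ)) (by omega)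
    simpa [Matrix.mul_apply, Fin.sum_univ_castSucc, emb_cc, emb_lc, dotProduct, blockV, deltaPlus]
      using this
  have hA : ∀ i j : Fin n, (X * emb (deltaPlus X)) i.castSucc j.castSucc =
      (blockA X * deltaPlus X) i j := by
    intro i j
    simp [Matrix.mul_apply, Fin.sum_univ_castSucc, emb_cc, emb_lc, blockA]
  have hcol : ∀ i : Fin (n + 1), (X * emb (deltaPlus X)) i (Fin.last n) = X i (Fin.last n) := by
    intro i
    simp [Matrix.mul_apply, Fin.sum_univ_castSucc, emb_cl, emb_ll]
  obtain ⟨m, rfl⟩ : ∃ m, n = m + 1 := ⟨n - 1, by omega⟩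
  ext i j
  refine Fin.cases ?_ (fun j => ?_) j
  · rw [mul_xiPlus_zero, ← Fin.castSucc_zero]
    refine Fin.lastCases ?_ (fun i => ?_) i
    · exact hv 0
    · rw [hA, key]
      have : m + 1 - 1 - ((0 : Fin (m + 1)) : ℕ) + 1 = m + 1 := by simp
      rw [this, pow_blockA_eq_zero hX]
      simp
  · rw [mul_xiPlus_succ]
    refine Fin.lastCases ?_ (fun j => ?_) j
    · rw [Fin.succ_last, hcol]
      refine Fin.lastCases ?_ (fun i => ?_) i
      · rw [w_eq_zero hX, emb_lc]
      · rw [emb_cc]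
        simp [deltaPlus, blockU]
    · rw [← Fin.castSucc_succ]
      refine Fin.lastCases ?_ (fun i => ?_) i
      · rw [hv, emb_lc]
      · rw [hA, key, emb_cc]
        have : m + 1 - 1 - ((j.succ : Fin (m + 1)) : ℕ) + 1 =
          m + 1 - 1 - ((j.castSucc : Fin (m + 1)) : ℕ) := by
          simp
          omega
        rw [this]
        rfl

lemma xi_imp_plus {X : Matrix (Fin (n + 1)) (Fin (n + 1)) F}
    (h : GeneralLinearGroup (Fin n) F) (hh : act h X = xiPlus n) : DeltaPlus X ≠ 0 := by
  rw [act_eq_iff'] at hh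
  set D : Matrix (Fin n) (Fin n) F :=
    ((h⁻¹ : GeneralLinearGroup (Fin n) F) : Matrix (Fin n) (Fin n) F) with hDdef
  have key : ∀ k : ℕ, ∀ j : Fin n, (j : ℕ) + 1 + k = n → ∀ i,
      (blockA X ^ k *ᵥ blockU X) i = D i j := by
    intro k
    induction k with
    | zero =>
      intro j hj i
      have e : j.succ = Fin.last n := Fin.ext (by simpa using hj)
      have := congrFun (congrFun hh i.castSucc) j.succ
      rw [mul_xiPlus_succ, e, emb_cc] at this
      rw [← this]
      simp [Matrix.mul_apply, Fin.sum_univ_castSucc, emb_cl, emb_ll, blockU]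
    | succ k ih =>
      intro j hj i
      have ih' := ih ⟨j + 1, by omega⟩ (by simp; omega)
      rw [pow_succ', ← Matrix.mulVec_mulVec]
      have := congrFun (congrFun hh i.castSucc) j.succ
      have e : j.succ = (⟨j + 1, by omega⟩ : Fin n).castSucc := rfl
      rw [mul_xiPlus_succ, emb_cc, e] at this
      rw [← this]
      rw [Matrix.mul_apply, Fin.sum_univ_castSucc, emb_lc, mul_zero, add_zero]
      change ∑ l, blockA X i l * (blockA X ^ k *ᵥ blockU X) l = _
      refine Finset.sum_congr rfl (fun l _ => ?_)
      rw [ih' l, emb_cc]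
      rfl
  have : deltaPlus X = D := by
    ext i j
    exact key _ j (by omega) i
  unfold DeltaPlus
  rw [this]
  exact ((Matrix.isUnit_iff_isUnit_det _).mp (h⁻¹).isUnit).ne_zero

lemma act_transpose (h : GeneralLinearGroup (Fin n) F)
    (X Y : Matrix (Fin (n + 1)) (Fin (n + 1)) F) (e : act h X = Y) :
    ∃ g : GeneralLinearGroup (Fin n) F, act g Xᵀ = Yᵀ := by
  have hd : ((h : Matrix (Fin n) (Fin n) F)ᵀ).det ≠ 0 := by
    rw [Matrix.det_transpose]
    exact ((Matrix.isUnit_iff_isUnit_det _).mp h.isUnit).ne_zero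
  refine ⟨(Matrix.GeneralLinearGroup.mkOfDetNeZero _ hd)⁻¹, ?_⟩
  rw [act_eq_iff', inv_inv]
  change Xᵀ * emb (h : Matrix (Fin n) (Fin n) F)ᵀ = emb (h : Matrix (Fin n) (Fin n) F)ᵀ * Yᵀ
  rw [act_eq_iff] at e
  rw [← emb_transpose, ← Matrix.transpose_mul, e, Matrix.transpose_mul]

lemma xi_iff (hn : 1 ≤ n) {X : Matrix (Fin (n + 1)) (Fin (n + 1)) F} (hX : invMap X = 0) :
    (∃ h : GeneralLinearGroup (Fin n) F, act h X = xiPlus n ∨ act h X = (xiPlus n)ᵀ) ↔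
      (DeltaPlus X ≠ 0 ∨ DeltaMinus X ≠ 0) := by
  constructor
  · rintro ⟨h, hh | hh⟩
    · exact Or.inl (xi_imp_plus h hh)
    · obtain ⟨g, hg⟩ := act_transpose _ _ _ hh
      rw [Matrix.transpose_transpose] at hg
      exact Or.inr ((DeltaPlus_transpose X).mp (xi_imp_plus g hg))
  · rintro (hD | hD)
    · obtain ⟨h, hh⟩ := plus_imp_xi hn hX hD
      exact ⟨h, Or.inl hh⟩
    · obtain ⟨h, hh⟩ := plus_imp_xi hn (invMap_transpose hX) ((DeltaPlus_transpose X).mpr hD)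
      obtain ⟨g, hg⟩ := act_transpose _ _ _ hh
      rw [Matrix.transpose_transpose] at hg
      exact ⟨g, Or.inr hg⟩

end helpers

end ZhangRTF

/-- Lemma 6.1: for `X` in the nilpotent cone, regularity, being `GL_n(F)`-equivalent to
`ξ₊` or `ξ₋`, and non-vanishing of `Δ₊` or `Δ₋` are all equivalent. -/
theorem lemma_6_1 (n : ℕ) (hn : 1 ≤ n) (F : Type*) [Field F] [Infinite F]
    (X : Matrix (Fin (n + 1)) (Fin (n + 1)) F) (hX : invMap X = 0) :
    ((∀ h : Matrix.GeneralLinearGroup (Fin n) F, act h X = X → h = 1) ↔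
      ∃ h : Matrix.GeneralLinearGroup (Fin n) F, act h X = xiPlus n ∨ act h X = (xiPlus n)ᵀ) ∧
    ((∃ h : Matrix.GeneralLinearGroup (Fin n) F, act h X = xiPlus n ∨ act h X = (xiPlus n)ᵀ) ↔
      (DeltaPlus X ≠ 0 ∨ DeltaMinus X ≠ 0)) := by
  refine ⟨?_, xi_iff hn hX⟩
  rw [xi_iff hn hX]
  exact ⟨regular_imp hX, imp_regular⟩
end

section
/- (Proposition: the regular section σ trivializes M_{n+1,+}) The map ι : GL_n(F) × (F^n × F^{n+1}) → M_{n+1}(F), (h,(a,b)) ↦ h·σ(a,b), is a bijection onto M_{n+1,+}, with inverse given by X ↦ (δ_+(X), π(X)). In particular, for every X ∈ M_{n+1}(F) with Δ_+(X) ≠ 0 there exist a unique h ∈ GL_n(F) and a unique (a,b) ∈ F^n × F^{n+1} with X = h·σ(a,b), and they are h = δ_+(X) and (a,b) = π(X). -/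
open Matrix MeasureTheory

open ZhangRTF

section Helpers

variable {F : Type*} [Field F] {n : ℕ}

theorem aux_emb_cc (h : Matrix (Fin n) (Fin n) F) (i j : Fin n) :
    emb h i.castSucc j.castSucc = h i j := by simp [emb]

theorem aux_emb_cl (h : Matrix (Fin n) (Fin n) F) (i : Fin n) :
    emb h i.castSucc (Fin.last n) = 0 := by simp [emb]

theorem aux_emb_lc (h : Matrix (Fin n) (Fin n) F) (j : Fin n) :
    emb h (Fin.last n) j.castSucc = 0 := by simp [emb]

theorem aux_emb_ll (h : Matrix (Fin n) (Fin n) F) :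
    emb h (Fin.last n) (Fin.last n) = 1 := by simp [emb]

theorem aux_block_ext {X Y : Matrix (Fin (n + 1)) (Fin (n + 1)) F}
    (hA : blockA X = blockA Y) (hU : blockU X = blockU Y) (hV : blockV X = blockV Y)
    (hW : blockW X = blockW Y) : X = Y := by
  ext i j
  refine Fin.lastCases ?_ (fun i => ?_) i <;> refine Fin.lastCases ?_ (fun j => ?_) j
  · exact hW
  · exact congrFun hV j
  · exact congrFun hU i
  · exact congrFun (congrFun hA i) j

theorem aux_A_left (h : Matrix (Fin n) (Fin n) F) (X : Matrix (Fin (n + 1)) (Fin (n + 1)) F) :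
    blockA (emb h * X) = h * blockA X := by
  ext i j
  simp [blockA, Matrix.mul_apply, Fin.sum_univ_castSucc, aux_emb_cc, aux_emb_cl]

theorem aux_U_left (h : Matrix (Fin n) (Fin n) F) (X : Matrix (Fin (n + 1)) (Fin (n + 1)) F) :
    blockU (emb h * X) = h *ᵥ blockU X := by
  ext i
  simp [blockU, Matrix.mul_apply, Matrix.mulVec, dotProduct, Fin.sum_univ_castSucc,
    aux_emb_cc, aux_emb_cl]

theorem aux_V_left (h : Matrix (Fin n) (Fin n) F) (X : Matrix (Fin (n + 1)) (Fin (n + 1)) F) :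
    blockV (emb h * X) = blockV X := by
  ext i
  simp [blockV, Matrix.mul_apply, Fin.sum_univ_castSucc, aux_emb_lc, aux_emb_ll]

theorem aux_W_left (h : Matrix (Fin n) (Fin n) F) (X : Matrix (Fin (n + 1)) (Fin (n + 1)) F) :
    blockW (emb h * X) = blockW X := by
  simp [blockW, Matrix.mul_apply, Fin.sum_univ_castSucc, aux_emb_lc, aux_emb_ll]

theorem aux_A_right (h : Matrix (Fin n) (Fin n) F) (X : Matrix (Fin (n + 1)) (Fin (n + 1)) F) :
    blockA (X * emb h) = blockA X * h := by
  ext i j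
  simp [blockA, Matrix.mul_apply, Fin.sum_univ_castSucc, aux_emb_cc, aux_emb_lc]

theorem aux_U_right (h : Matrix (Fin n) (Fin n) F) (X : Matrix (Fin (n + 1)) (Fin (n + 1)) F) :
    blockU (X * emb h) = blockU X := by
  ext i
  simp [blockU, Matrix.mul_apply, Fin.sum_univ_castSucc, aux_emb_cl, aux_emb_ll]

theorem aux_V_right (h : Matrix (Fin n) (Fin n) F) (X : Matrix (Fin (n + 1)) (Fin (n + 1)) F) :
    blockV (X * emb h) = blockV X ᵥ* h := by
  ext i
  simp [blockV, Matrix.mul_apply, Matrix.vecMul, dotProduct, Fin.sum_univ_castSucc,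
    aux_emb_cc, aux_emb_lc]

theorem aux_W_right (h : Matrix (Fin n) (Fin n) F) (X : Matrix (Fin (n + 1)) (Fin (n + 1)) F) :
    blockW (X * emb h) = blockW X := by
  simp [blockW, Matrix.mul_apply, Fin.sum_univ_castSucc, aux_emb_cl, aux_emb_ll]

theorem aux_emb_mul_inv (h : Matrix.GeneralLinearGroup (Fin n) F) :
    emb (h : Matrix (Fin n) (Fin n) F) *
      emb ((h⁻¹ : Matrix.GeneralLinearGroup (Fin n) F) : Matrix (Fin n) (Fin n) F) = 1 := by
  have h1 : (h : Matrix (Fin n) (Fin n) F) *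
    ((h⁻¹ : Matrix.GeneralLinearGroup (Fin n) F) : Matrix (Fin n) (Fin n) F) = 1 := h.mul_inv
  have e1 : ∀ k : Matrix (Fin n) (Fin n) F, blockA (emb k) = k := fun k => by
    ext i j; simp [blockA, aux_emb_cc]
  apply aux_block_ext
  · rw [aux_A_left, e1, h1]; ext i j; simp [blockA, Matrix.one_apply]
  · rw [aux_U_right]; ext i; simp [blockU, aux_emb_cl, Matrix.one_apply, Fin.ext_iff, i.2.ne]
  · rw [aux_V_left]; ext i; simp [blockV, aux_emb_lc, Matrix.one_apply, Fin.ext_iff, i.2.ne']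
  · rw [aux_W_left]; simp [blockW, aux_emb_ll]

/-- Cayley-Hamilton applied to a vector. -/
theorem aux_CH (X : Matrix (Fin (n + 1)) (Fin (n + 1)) F) :
    blockA X ^ n *ᵥ blockU X = deltaPlus X *ᵥ aInv X := by
  have h := Matrix.aeval_self_charpoly (blockA X)
  rw [Polynomial.aeval_eq_sum_range, Matrix.charpoly_natDegree_eq_dim, Fintype.card_fin,
    Finset.sum_range_succ] at h
  have hc : (blockA X).charpoly.coeff n = 1 := by
    have := (Matrix.charpoly_monic (blockA X)).coeff_natDegree
    rwa [Matrix.charpoly_natDegree_eq_dim, Fintype.card_fin] at this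
  rw [hc, one_smul] at h
  rw [eq_neg_of_add_eq_zero_right h, ← Finset.sum_range_reflect, ← Fin.sum_univ_eq_sum_range
    (fun j => (blockA X).charpoly.coeff (n - 1 - j) • blockA X ^ (n - 1 - j))]
  rw [Matrix.neg_mulVec, Matrix.sum_mulVec]
  ext i
  rw [Pi.neg_apply, Finset.sum_apply, ← Finset.sum_neg_distrib]
  refine Finset.sum_congr rfl fun j _ => ?_
  rw [Matrix.smul_mulVec]
  simp only [deltaPlus, aInv, Matrix.of_apply, Pi.smul_apply, smul_eq_mul]
  ring

theorem aux_sig_u_col (hn : 1 ≤ n) (a : Fin n → F) (b : Fin (n + 1) → F) :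
    blockU (sectSigma a b) = Pi.single (⟨n - 1, by omega⟩ : Fin n) 1 := by
  ext i
  have := i.2
  by_cases h : i = ⟨n - 1, by omega⟩
  · have h' : (i : ℕ) = n - 1 := congrArg Fin.val h
    rw [← h]
    simp [blockU, sectSigma]; rw [if_neg (by omega), if_pos (by omega)]; simp
  · have h' : (i : ℕ) ≠ n - 1 := fun e => h (Fin.ext e)
    simp [blockU, sectSigma, h]; rw [if_neg (by omega), if_neg (by omega)]; simp

theorem aux_sig_col0 (hn : 1 ≤ n) (a : Fin n → F) (b : Fin (n + 1) → F) :
    blockA (sectSigma a b) *ᵥ Pi.single (⟨0, by omega⟩ : Fin n) 1 = a := by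
  ext i
  simp [blockA, sectSigma]

theorem aux_sig_colS (a : Fin n → F) (b : Fin (n + 1) → F) (k : ℕ) (hk : k + 1 < n) :
    blockA (sectSigma a b) *ᵥ Pi.single (⟨k + 1, hk⟩ : Fin n) 1 =
      Pi.single (⟨k, by omega⟩ : Fin n) 1 := by
  ext i
  rw [Matrix.mulVec_single_one, Matrix.col_apply, Pi.single_apply]
  simp only [blockA, sectSigma, Matrix.of_apply, Fin.val_castSucc, i.2, dif_pos, Fin.ext_iff]
  rw [if_neg (by omega), zero_add]
  exact if_congr (by omega) rfl rfl

theorem aux_sig_pow (hn : 1 ≤ n) (a : Fin n → F) (b : Fin (n + 1) → F) (k : ℕ) (hk : k < n) :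
    blockA (sectSigma a b) ^ k *ᵥ blockU (sectSigma a b) =
      Pi.single (⟨n - 1 - k, by omega⟩ : Fin n) 1 := by
  induction k with
  | zero => simpa using aux_sig_u_col hn a b
  | succ k ih =>
    rw [pow_succ', ← Matrix.mulVec_mulVec, ih (by omega)]
    have e : n - 1 - k = (n - 1 - (k + 1)) + 1 := by omega
    simp only [e]
    exact aux_sig_colS a b _ _

theorem aux_sig_delta (hn : 1 ≤ n) (a : Fin n → F) (b : Fin (n + 1) → F) :
    deltaPlus (sectSigma a b) = 1 := by
  ext i j
  have := j.2
  have e : n - 1 - (n - 1 - (j : ℕ)) = j := by omega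
  simp only [deltaPlus, Matrix.of_apply]
  rw [aux_sig_pow hn a b _ (by omega)]
  simp [e, Matrix.one_apply, Pi.single_apply]

theorem aux_sig_a (hn : 1 ≤ n) (a : Fin n → F) (b : Fin (n + 1) → F) :
    aInv (sectSigma a b) = a := by
  have h := aux_CH (sectSigma a b)
  rw [aux_sig_delta hn, Matrix.one_mulVec] at h
  rw [← h]
  obtain ⟨m, rfl⟩ : ∃ m, n = m + 1 := ⟨n - 1, by omega⟩
  rw [pow_succ', ← Matrix.mulVec_mulVec, aux_sig_pow hn a b m (by omega)]
  simpa using aux_sig_col0 hn a b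

theorem aux_sig_v (a : Fin n → F) (b : Fin (n + 1) → F) (j : Fin n) :
    blockV (sectSigma a b) j = b j.castSucc.rev := by
  simp [blockV, sectSigma]

theorem aux_sig_w (a : Fin n → F) (b : Fin (n + 1) → F) :
    blockW (sectSigma a b) = b 0 := by
  simp [blockW, sectSigma]

theorem aux_sig_b (hn : 1 ≤ n) (a : Fin n → F) (b : Fin (n + 1) → F) :
    bInv (sectSigma a b) = b := by
  ext j
  have := j.2
  unfold bInv
  split_ifs with h
  · rw [aux_sig_w]; congr 1; exact Fin.ext h.symm
  · rw [aux_sig_pow hn a b _ (by omega), dotProduct_single, aux_sig_v, mul_one]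
    congr 1
    apply Fin.ext
    simp [Fin.val_rev]
    omega

theorem aux_act_iff (h : Matrix.GeneralLinearGroup (Fin n) F)
    (X Y : Matrix (Fin (n + 1)) (Fin (n + 1)) F) :
    act h Y = X ↔ emb (h : Matrix (Fin n) (Fin n) F) * Y = X * emb (h : Matrix (Fin n) (Fin n) F) := by
  have h1 := aux_emb_mul_inv h
  have h2 := mul_eq_one_comm.mp h1
  unfold act
  constructor
  · rintro rfl
    rw [mul_assoc _ _ (emb (h : Matrix (Fin n) (Fin n) F)), h2, mul_one]
  · intro e
    rw [e, mul_assoc, h1, mul_one]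


theorem aux_conj (h : Matrix.GeneralLinearGroup (Fin n) F)
    (X Y : Matrix (Fin (n + 1)) (Fin (n + 1)) F) (e : act h Y = X) :
    blockA X * (h : Matrix (Fin n) (Fin n) F) = (h : Matrix (Fin n) (Fin n) F) * blockA Y ∧
    blockU X = (h : Matrix (Fin n) (Fin n) F) *ᵥ blockU Y ∧
    blockV X ᵥ* (h : Matrix (Fin n) (Fin n) F) = blockV Y ∧ blockW X = blockW Y := by
  rw [aux_act_iff] at e
  refine ⟨?_, ?_, ?_, ?_⟩
  · rw [← aux_A_left, e, aux_A_right]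
  · rw [← aux_U_left, e, aux_U_right]
  · rw [← aux_V_right, ← e, aux_V_left]
  · rw [← aux_W_left (h : Matrix (Fin n) (Fin n) F) Y, e, aux_W_right]

theorem aux_conj_pow (h : Matrix.GeneralLinearGroup (Fin n) F)
    (X Y : Matrix (Fin (n + 1)) (Fin (n + 1)) F) (e : act h Y = X) (k : ℕ) :
    blockA X ^ k *ᵥ blockU X =
      (h : Matrix (Fin n) (Fin n) F) *ᵥ (blockA Y ^ k *ᵥ blockU Y) := by
  obtain ⟨hA, hU, -, -⟩ := aux_conj h X Y e
  induction k with
  | zero => simpa using hU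
  | succ k ih =>
    rw [pow_succ', ← Matrix.mulVec_mulVec, ih, Matrix.mulVec_mulVec, hA, pow_succ',
      ← Matrix.mulVec_mulVec, ← Matrix.mulVec_mulVec]

theorem aux_conj_delta (h : Matrix.GeneralLinearGroup (Fin n) F)
    (X Y : Matrix (Fin (n + 1)) (Fin (n + 1)) F) (e : act h Y = X) :
    deltaPlus X = (h : Matrix (Fin n) (Fin n) F) * deltaPlus Y := by
  ext i j
  simp only [deltaPlus, Matrix.of_apply]
  rw [aux_conj_pow h X Y e]
  rfl

theorem aux_conj_a (h : Matrix.GeneralLinearGroup (Fin n) F)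
    (X Y : Matrix (Fin (n + 1)) (Fin (n + 1)) F) (e : act h Y = X) : aInv X = aInv Y := by
  obtain ⟨hA, -, -, -⟩ := aux_conj h X Y e
  have : blockA X = h.val * blockA Y * (h⁻¹).val := by
    rw [← hA, mul_assoc, h.mul_inv, mul_one]
  unfold aInv
  rw [this, Matrix.coe_units_inv, Matrix.charpoly_units_conj]

theorem aux_conj_b (h : Matrix.GeneralLinearGroup (Fin n) F)
    (X Y : Matrix (Fin (n + 1)) (Fin (n + 1)) F) (e : act h Y = X) : bInv X = bInv Y := by
  obtain ⟨-, -, hV, hW⟩ := aux_conj h X Y e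
  ext j
  unfold bInv
  rw [hW, aux_conj_pow h X Y e, Matrix.dotProduct_mulVec, hV]

theorem aux_main (hn : 1 ≤ n) (X : Matrix (Fin (n + 1)) (Fin (n + 1)) F)
    (h : Matrix.GeneralLinearGroup (Fin n) F) (a : Fin n → F) (b : Fin (n + 1) → F)
    (e : act h (sectSigma a b) = X) :
    (h : Matrix (Fin n) (Fin n) F) = deltaPlus X ∧ a = aInv X ∧ b = bInv X := by
  refine ⟨?_, ?_, ?_⟩
  · rw [aux_conj_delta h X _ e, aux_sig_delta hn, mul_one]
  · rw [aux_conj_a h X _ e, aux_sig_a hn]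
  · rw [aux_conj_b h X _ e, aux_sig_b hn]

theorem aux_exists (hn : 1 ≤ n) (X : Matrix (Fin (n + 1)) (Fin (n + 1)) F)
    (h : Matrix.GeneralLinearGroup (Fin n) F)
    (hh : (h : Matrix (Fin n) (Fin n) F) = deltaPlus X) :
    act h (sectSigma (aInv X) (bInv X)) = X := by
  rw [aux_act_iff, hh]
  have col : ∀ (k : ℕ) (hk : k < n), deltaPlus X *ᵥ Pi.single (⟨k, hk⟩ : Fin n) 1 =
      blockA X ^ (n - 1 - k) *ᵥ blockU X := by
    intro k hk
    ext i
    simp [deltaPlus]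
  apply aux_block_ext
  · rw [aux_A_left, aux_A_right]
    apply Matrix.ext_of_mulVec_single
    rintro ⟨k, hk⟩
    rw [← Matrix.mulVec_mulVec, ← Matrix.mulVec_mulVec, col,
      Matrix.mulVec_mulVec (blockU X), ← pow_succ']
    cases k with
    | zero =>
      rw [aux_sig_col0 hn, ← aux_CH]
      congr 2
      omega
    | succ k =>
      rw [aux_sig_colS, col]
      congr 2
      omega
  · rw [aux_U_left, aux_U_right, aux_sig_u_col hn, col]
    simp
  · rw [aux_V_left, aux_V_right]
    ext j
    have := j.2
    rw [aux_sig_v]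
    have e : ((j.castSucc.rev : Fin (n + 1)) : ℕ) = n - j := by simp [Fin.val_rev]
    have e2 : n - (j : ℕ) - 1 = n - 1 - j := by omega
    unfold bInv
    rw [e, if_neg (by omega), e2]
    rfl
  · rw [aux_W_left, aux_W_right, aux_sig_w]
    simp [bInv]

end Helpers

/-- The map `(h,(a,b)) ↦ h·σ(a,b)` is a bijection onto `M_{n+1,+}`, with inverse
`X ↦ (δ₊(X), π(X))`. -/
theorem sigma_trivialization (n : ℕ) (hn : 1 ≤ n) (F : Type*) [Field F] :
    (∀ (h : Matrix.GeneralLinearGroup (Fin n) F) (a : Fin n → F) (b : Fin (n + 1) → F),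
      DeltaPlus (act h (sectSigma a b)) ≠ 0) ∧
    (∀ X : Matrix (Fin (n + 1)) (Fin (n + 1)) F, DeltaPlus X ≠ 0 →
      ∃! p : Matrix.GeneralLinearGroup (Fin n) F × ((Fin n → F) × (Fin (n + 1) → F)),
        act p.1 (sectSigma p.2.1 p.2.2) = X) ∧
    (∀ X : Matrix (Fin (n + 1)) (Fin (n + 1)) F, DeltaPlus X ≠ 0 →
      ∀ (h : Matrix.GeneralLinearGroup (Fin n) F) (a : Fin n → F) (b : Fin (n + 1) → F),
        act h (sectSigma a b) = X →
          ((h : Matrix (Fin n) (Fin n) F) = deltaPlus X ∧ a = aInv X ∧ b = bInv X)) := by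
  refine ⟨?_, ?_, ?_⟩
  · intro h a b
    unfold DeltaPlus
    rw [← (aux_main hn _ h a b rfl).1]
    exact ((Matrix.isUnit_iff_isUnit_det _).mp h.isUnit).ne_zero
  · intro X hX
    have hu : IsUnit (deltaPlus X) :=
      (Matrix.isUnit_iff_isUnit_det _).mpr (isUnit_iff_ne_zero.mpr hX)
    obtain ⟨h, hh⟩ := hu
    refine ⟨(h, (aInv X, bInv X)), aux_exists hn X h hh, ?_⟩
    rintro ⟨h', a, b⟩ e
    obtain ⟨h1, h2, h3⟩ := aux_main hn X h' a b e
    have h4 : h' = h := Units.ext (h1.trans hh.symm)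
    rw [h4, h2, h3]
  · intro X _ h a b e
    exact aux_main hn X h a b e
end

section
/- (Corollary, part 2: triangularity of π∘σ′) Write π(σ′(a, b′)) = (a″, b) for (a, b′) ∈ F^n × F^{n+1}, where b′ = (b′_0,…,b′_n) and b = (b_0,…,b_n). Then a″ = a and b_0 = b′_0, and for each 1 ≤ i ≤ n there exists a polynomial map φ_i : F^n × F^{i−1} → F such that b_i = b′_i + φ_i(a, b′_1, …, b′_{i−1}) for all (a,b′). In particular, the map (a, b′) ↦ π(σ′(a, b′)) is a bijection of F^n × F^{n+1} onto itself. -/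
open Matrix MeasureTheory

open ZhangRTF

section Helpers

variable {F : Type*} [Field F] {n : ℕ}

/-- The upper-left block of `σ'` as a companion matrix. -/
def compA (a : Fin n → F) : Matrix (Fin n) (Fin n) F :=
  Matrix.of fun i j =>
    if (i : ℕ) < n - 1 then (if (j : ℕ) = (i : ℕ) + 1 then 1 else 0)
    else a ⟨n - 1 - (j : ℕ), by omega⟩

/-- The last standard column vector. -/
def lastU (F : Type*) [Field F] (n : ℕ) : Fin n → F :=
  fun i => if (i : ℕ) = n - 1 then 1 else 0

lemma blockA_sect (a : Fin n → F) (b : Fin (n + 1) → F) :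
    blockA (sectSigma' a b) = compA a := by
  ext i j
  have hi := i.isLt
  by_cases h : (i : ℕ) < n - 1
  · simp [blockA, sectSigma', compA, h]
  · have h' : (i : ℕ) = n - 1 := by omega
    simp [blockA, sectSigma', compA, h']

lemma blockU_sect (a : Fin n → F) (b : Fin (n + 1) → F) :
    blockU (sectSigma' a b) = lastU F n := by
  ext i
  have hi := i.isLt
  by_cases h : (i : ℕ) < n - 1
  · have h1 : ¬ (i : ℕ) = n - 1 := by omega
    have h2 : ¬ n = (i : ℕ) + 1 := by omega
    simp [blockU, sectSigma', lastU, h, h1, h2]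
  · have h' : (i : ℕ) = n - 1 := by omega
    simp [blockU, sectSigma', lastU, h']

lemma blockV_sect (hn : 1 ≤ n) (a : Fin n → F) (b : Fin (n + 1) → F) (j : Fin n) :
    blockV (sectSigma' a b) j = b j.castSucc.rev := by
  have h1 : ¬ n < n - 1 := by omega
  have h2 : ¬ n = n - 1 := by omega
  simp [blockV, sectSigma', h1, h2]

lemma blockW_sect (hn : 1 ≤ n) (a : Fin n → F) (b : Fin (n + 1) → F) :
    blockW (sectSigma' a b) = b 0 := by
  have h1 : ¬ n < n - 1 := by omega
  have h2 : ¬ n = n - 1 := by omega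
  simp [blockW, sectSigma', h1, h2]

lemma row_pow (hn : 1 ≤ n) (a : Fin n → F) (k : ℕ) (hk : k < n) :
    (compA a ^ k) ⟨0, hn⟩ = Pi.single (⟨k, hk⟩ : Fin n) 1 := by
  induction k with
  | zero => ext j; simp [Matrix.one_apply, Pi.single_apply, eq_comm]
  | succ k ih =>
    have hk' : k < n - 1 := by omega
    ext j
    rw [pow_succ, Matrix.mul_apply, ih (by omega)]
    simp only [Pi.single_apply, ite_mul, one_mul, zero_mul, Finset.sum_ite_eq', Finset.mem_univ, if_true]
    simp [compA, hk', Fin.ext_iff]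

lemma row_pow_n (hn : 1 ≤ n) (a : Fin n → F) (j : Fin n) :
    (compA a ^ n) ⟨0, hn⟩ j = a ⟨n - 1 - (j : ℕ), by omega⟩ := by
  obtain ⟨m, rfl⟩ : ∃ m, n = m + 1 := ⟨n - 1, by omega⟩
  rw [pow_succ, Matrix.mul_apply, row_pow hn a m (by omega)]
  simp only [Pi.single_apply, ite_mul, one_mul, zero_mul, Finset.sum_ite_eq', Finset.mem_univ, if_true]
  simp [compA]

lemma charpoly_compA (hn : 1 ≤ n) (a : Fin n → F) (j : Fin n) :
    (compA a).charpoly.coeff j = - a ⟨n - 1 - (j : ℕ), by omega⟩ := by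
  have h := Matrix.aeval_self_charpoly (compA a)
  have hd : (compA a).charpoly.natDegree = n := by
    simp [Matrix.charpoly_natDegree_eq_dim]
  have hm : (compA a).charpoly.coeff n = 1 := by
    have := Matrix.charpoly_monic (compA a)
    rw [Polynomial.Monic, Polynomial.leadingCoeff, hd] at this
    exact this
  rw [Polynomial.aeval_eq_sum_range, hd, Finset.sum_range_succ, hm] at h
  have h2 := congrFun (congrFun h ⟨0, hn⟩) j
  rw [Matrix.add_apply, Matrix.sum_apply, one_smul, row_pow_n, Finset.sum_range] at h2
  have h3 : ∀ i : Fin n, ((compA a).charpoly.coeff i • compA a ^ (i : ℕ)) ⟨0, hn⟩ j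
      = if j = i then (compA a).charpoly.coeff i else 0 := by
    intro i
    rw [Matrix.smul_apply, row_pow hn a i i.isLt]
    simp [Pi.single_apply]
  rw [Finset.sum_congr rfl (fun i _ => h3 i)] at h2
  simp at h2
  exact eq_neg_of_add_eq_zero_left h2

lemma col_poly (k : ℕ) : ∀ i : Fin n, ∃ P : MvPolynomial (Fin n) F, ∀ a : Fin n → F,
    (compA a ^ k *ᵥ lastU F n) i = MvPolynomial.eval a P := by
  induction k with
  | zero => intro i; exact ⟨MvPolynomial.C (lastU F n i), by simp⟩
  | succ k ih =>
    choose P hP using ih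
    intro i
    refine ⟨∑ j : Fin n, (if (i : ℕ) < n - 1 then
      (if (j : ℕ) = (i : ℕ) + 1 then 1 else 0)
      else MvPolynomial.X ⟨n - 1 - (j : ℕ), by omega⟩) * P j, fun a => ?_⟩
    rw [pow_succ', ← Matrix.mulVec_mulVec, Matrix.mulVec, dotProduct, map_sum]
    refine Finset.sum_congr rfl fun j _ => ?_
    rw [hP, map_mul]
    congr 1
    simp only [compA, Matrix.of_apply]
    split_ifs <;> simp

lemma col_tri (a : Fin n → F) (k : ℕ) : k < n → ∀ i : Fin n, (i : ℕ) + k ≤ n - 1 →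
    (compA a ^ k *ᵥ lastU F n) i = if (i : ℕ) + k = n - 1 then 1 else 0 := by
  induction k with
  | zero => intro _ i _; simp [lastU]
  | succ k ih =>
    intro hk i hi
    have h1 : (i : ℕ) < n - 1 := by omega
    rw [pow_succ', ← Matrix.mulVec_mulVec, Matrix.mulVec, dotProduct,
      Finset.sum_eq_single (⟨(i : ℕ) + 1, by omega⟩ : Fin n)]
    · rw [ih (by omega) _ (by simp; omega)]
      simp [compA, h1, add_assoc, add_comm 1 k]
    · intro j _ hj
      have : ¬ (j : ℕ) = (i : ℕ) + 1 := fun h => hj (Fin.ext h)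
      simp [compA, h1, this]
    · simp

lemma bInv_sect (hn : 1 ≤ n) (a : Fin n → F) (b : Fin (n + 1) → F) (i : Fin (n + 1)) :
    bInv (sectSigma' a b) i = if (i : ℕ) = 0 then b 0 else
      ∑ j : Fin n, b j.castSucc.rev * (compA a ^ ((i : ℕ) - 1) *ᵥ lastU F n) j := by
  rw [bInv, blockW_sect hn, blockA_sect, blockU_sect, dotProduct]
  simp only [blockV_sect hn]

lemma part_poly (hn : 1 ≤ n) (i : ℕ) (hi1 : 1 ≤ i) (hi2 : i ≤ n)
    (hlt : i < n + 1) (hk : ∀ k : Fin (i - 1), (k : ℕ) + 1 < n + 1) :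
      ∃ φ : MvPolynomial (Fin n ⊕ Fin (i - 1)) F,
        ∀ (a : Fin n → F) (b' : Fin (n + 1) → F),
          bInv (sectSigma' a b') ⟨i, hlt⟩ =
            b' ⟨i, hlt⟩ +
              MvPolynomial.eval
                (Sum.elim a fun k : Fin (i - 1) =>
                  b' ⟨(k : ℕ) + 1, hk k⟩) φ := by
  choose P hP using col_poly (F := F) (n := n) (i - 1)
  refine ⟨∑ j : Fin n, if h : n - i < (j : ℕ) then
    MvPolynomial.X (Sum.inr ⟨n - 1 - (j : ℕ), by omega⟩) *
      MvPolynomial.rename Sum.inl (P j) else 0, fun a b' => ?_⟩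
  rw [bInv_sect hn, if_neg (show ¬ i = 0 by omega), map_sum,
    ← Finset.add_sum_erase _ _ (Finset.mem_univ (⟨n - i, by omega⟩ : Fin n)),
    ← Finset.add_sum_erase (Finset.univ : Finset (Fin n)) (fun j => MvPolynomial.eval _ _)
      (Finset.mem_univ (⟨n - i, by omega⟩ : Fin n))]
  have e1 := col_tri a (i - 1) (by omega) ⟨n - i, by omega⟩ (by simp; omega)
  rw [if_pos (by simp; omega)] at e1
  have e2 : (⟨n - i, by omega⟩ : Fin n).castSucc.rev = (⟨i, hlt⟩ : Fin (n + 1)) := by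
    ext; simp [Fin.val_rev]; omega
  simp only [e1, e2, mul_one, lt_irrefl, dite_false, map_zero, zero_add]
  congr 1
  refine Finset.sum_congr rfl fun j hj => ?_
  have hj' : ¬ (j : ℕ) = n - i := fun h => (Finset.ne_of_mem_erase hj) (Fin.ext h)
  by_cases h : n - i < (j : ℕ)
  · rw [dif_pos h, map_mul, MvPolynomial.eval_X, MvPolynomial.eval_rename, hP]
    congr 1
    simp only [Sum.elim_inr]
    congr 1
    ext; simp [Fin.val_rev]; omega
  · rw [dif_neg h, map_zero, col_tri a (i - 1) (by omega) j (by omega), if_neg (by omega), mul_zero]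

lemma bInv_inj (hn : 1 ≤ n) (a : Fin n → F) :
    Function.Injective (fun b : Fin (n + 1) → F => bInv (sectSigma' a b)) := by
  intro b c h
  have key : ∀ i : ℕ, ∀ hi : i < n + 1, b ⟨i, hi⟩ = c ⟨i, hi⟩ := by
    intro i
    induction i using Nat.strong_induction_on with
    | _ i ih =>
      intro hi
      have h1 := congrFun h ⟨i, hi⟩
      rcases Nat.eq_zero_or_pos i with h0 | h0
      · subst h0
        simpa [bInv_sect hn] using h1
      · have hk : ∀ k : Fin (i - 1), (k : ℕ) + 1 < n + 1 := fun k => by omega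
        obtain ⟨φ, hφ⟩ := part_poly (F := F) hn i h0 (by omega) hi hk
        simp only [hφ] at h1
        have e : (fun k : Fin (i - 1) => b ⟨(k : ℕ) + 1, hk k⟩)
          = (fun k : Fin (i - 1) => c ⟨(k : ℕ) + 1, hk k⟩) := by
          funext k
          exact ih _ (by have := k.isLt; omega) _
        rw [e] at h1
        exact add_right_cancel h1
  funext i
  exact key i i.isLt

lemma bInv_surj (hn : 1 ≤ n) (a : Fin n → F) :
    Function.Surjective (fun b : Fin (n + 1) → F => bInv (sectSigma' a b)) := by
  let L : (Fin (n + 1) → F) →ₗ[F] (Fin (n + 1) → F) :=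
    { toFun := fun b => bInv (sectSigma' a b)
      map_add' := fun b c => by
        funext i
        simp only [Pi.add_apply, bInv_sect hn]
        split_ifs
        · rfl
        · simp only [add_mul, Finset.sum_add_distrib]
      map_smul' := fun r b => by
        funext i
        simp only [Pi.smul_apply, bInv_sect hn, smul_eq_mul, RingHom.id_apply]
        split_ifs
        · rfl
        · simp only [mul_assoc, Finset.mul_sum] }
  exact LinearMap.injective_iff_surjective.mp (show Function.Injective L from bInv_inj hn a)

lemma aInv_sect (hn : 1 ≤ n) (a : Fin n → F) (b : Fin (n + 1) → F) :
    aInv (sectSigma' a b) = a := by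
  funext i
  have := charpoly_compA hn a ⟨n - 1 - (i : ℕ), by omega⟩
  simp only at this
  rw [aInv, blockA_sect, this, neg_neg]
  congr 1
  ext; simp; omega

end Helpers

/-- Triangularity of `π ∘ σ'`: writing `π(σ'(a,b')) = (a'',b)`, one has `a'' = a`,
`b₀ = b'₀`, each `b_i` differs from `b'_i` by a polynomial in `a` and `b'_1, …, b'_{i-1}`,
and `π ∘ σ'` is a bijection. -/
theorem sigma'_triangular (n : ℕ) (hn : 1 ≤ n) (F : Type*) [Field F] :
    (∀ (a : Fin n → F) (b' : Fin (n + 1) → F),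
      aInv (sectSigma' a b') = a ∧ bInv (sectSigma' a b') 0 = b' 0) ∧
    (∀ (i : ℕ) (hi1 : 1 ≤ i) (hi2 : i ≤ n),
      ∃ φ : MvPolynomial (Fin n ⊕ Fin (i - 1)) F,
        ∀ (a : Fin n → F) (b' : Fin (n + 1) → F),
          bInv (sectSigma' a b') ⟨i, by omega⟩ =
            b' ⟨i, by omega⟩ +
              MvPolynomial.eval
                (Sum.elim a fun k : Fin (i - 1) =>
                  b' ⟨(k : ℕ) + 1, by have := k.isLt; omega⟩) φ) ∧
    Function.Bijective
      (fun p : (Fin n → F) × (Fin (n + 1) → F) => invMap (sectSigma' p.1 p.2)) := by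
  refine ⟨fun a b' => ⟨aInv_sect hn a b', by simp [bInv_sect hn]⟩,
    fun i hi1 hi2 => part_poly hn i hi1 hi2 _ _, ?_, ?_⟩
  · rintro ⟨a, b⟩ ⟨c, d⟩ h
    simp only [invMap, aInv_sect hn, Prod.mk.injEq] at h
    obtain ⟨rfl, h⟩ := h
    rw [bInv_inj hn a h]
  · rintro ⟨a, b⟩
    obtain ⟨b', hb⟩ := bInv_surj hn a b
    exact ⟨(a, b'), Prod.ext (aInv_sect hn a b') hb⟩
end

section
/- (Lemma on the subvariety 𝒲, part 1) A matrix X ∈ M_{n+1}(F) lies in 𝒲 if and only if δ_+(X) ∈ N_{n,−}. In particular every X ∈ 𝒲 satisfies Δ_+(X) ≠ 0. Moreover, if X ∈ 𝒲 and X = h·σ′(a,b) with h ∈ GL_n(F) and (a,b) ∈ F^n × F^{n+1}, then h ∈ N_{n,−}; conversely, u·σ′(a,b) ∈ 𝒲 for every u ∈ N_{n,−} and every (a,b) ∈ F^n × F^{n+1}. -/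
open Matrix MeasureTheory

open ZhangRTF

namespace ZhangRTF

variable {F : Type*} [Field F] {n : ℕ}

lemma sum_single_aux (f g : Fin n → F) (p : Fin n) (h1 : g p = 1) (h2 : ∀ m, m < p → g m = 0)
    (h3 : ∀ m, p < m → f m = 0) : ∑ m, f m * g m = f p := by
  rw [Finset.sum_eq_single p]
  · rw [h1, mul_one]
  · intro m _ hm
    rcases lt_or_gt_of_ne hm with h | h
    · rw [h2 m h, mul_zero]
    · rw [h3 m h, zero_mul]
  · intro h; exact absurd (Finset.mem_univ p) h

lemma mul_lower_apply (h L : Matrix (Fin n) (Fin n) F) (hL : IsLowerUni L) (i j : Fin n)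
    (hz : ∀ m, j < m → h i m = 0) : (h * L) i j = h i j := by
  rw [Matrix.mul_apply]
  exact sum_single_aux (fun m => h i m) (fun m => L m j) j (hL.1 j) (fun m hm => hL.2 m j hm) hz

lemma lower_mul (h L : Matrix (Fin n) (Fin n) F) (hh : IsLowerUni h) (hL : IsLowerUni L) :
    IsLowerUni (h * L) := by
  refine ⟨fun i => ?_, fun i j hij => ?_⟩
  · rw [mul_lower_apply h L hL i i (fun m hm => hh.2 i m hm), hh.1]
  · rw [mul_lower_apply h L hL i j (fun m hm => hh.2 i m (hij.trans hm)), hh.2 i j hij]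

lemma lower_of_mul (h L : Matrix (Fin n) (Fin n) F) (hD : IsLowerUni (h * L))
    (hL : IsLowerUni L) : IsLowerUni h := by
  have key : ∀ k : ℕ, ∀ i j : Fin n, n - 1 - (j : ℕ) = k → i ≤ j → (h * L) i j = h i j := by
    intro k
    induction k using Nat.strong_induction_on with
    | _ k ih =>
      intro i j hk hij
      refine mul_lower_apply h L hL i j (fun m hm => ?_)
      have hlt : i < m := lt_of_le_of_lt hij hm
      rw [← ih (n - 1 - (m : ℕ)) (by have := m.2; have : (j : ℕ) < m := hm; omega) i m rfl hlt.le]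
      exact hD.2 i m hlt
  refine ⟨fun i => ?_, fun i j hij => ?_⟩
  · rw [← key _ i i rfl le_rfl, hD.1]
  · rw [← key _ i j rfl hij.le, hD.2 i j hij]

lemma delta_last (X : Matrix (Fin (n + 1)) (Fin (n + 1)) F) (i j : Fin n)
    (hj : (j : ℕ) + 1 = n) : deltaPlus X i j = X i.castSucc j.succ := by
  have e : n - 1 - (j : ℕ) = 0 := by omega
  have e2 : j.succ = Fin.last n := Fin.ext (by simpa using hj)
  simp [deltaPlus, e, e2, blockU]

lemma delta_succ (X : Matrix (Fin (n + 1)) (Fin (n + 1)) F) (i j j' : Fin n)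
    (hj : (j' : ℕ) = j + 1) :
    deltaPlus X i j = ∑ m, X i.castSucc m.castSucc * deltaPlus X m j' := by
  have e : n - 1 - (j : ℕ) = (n - 1 - (j' : ℕ)) + 1 := by have := j'.2; omega
  simp only [deltaPlus, Matrix.of_apply, e, pow_succ']
  rw [← Matrix.mulVec_mulVec]
  rfl

lemma delta_key (X : Matrix (Fin (n + 1)) (Fin (n + 1)) F) (i j : Fin n)
    (h1 : ∀ m : Fin n, (m : ℕ) = j + 1 → deltaPlus X m m = 1)
    (h2 : ∀ m p : Fin n, (p : ℕ) = j + 1 → m < p → deltaPlus X m p = 0)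
    (h3 : ∀ m : Fin n, (j : ℕ) < m → X i.castSucc m.succ = 0) :
    deltaPlus X i j = X i.castSucc j.succ := by
  by_cases hj : (j : ℕ) + 1 = n
  · exact delta_last X i j hj
  · have hlt : (j : ℕ) + 1 < n := by have := j.2; omega
    rw [delta_succ X i j ⟨j + 1, hlt⟩ rfl,
      sum_single_aux (fun m : Fin n => X i.castSucc m.castSucc) (fun m => deltaPlus X m ⟨j + 1, hlt⟩)
        ⟨j + 1, hlt⟩ (h1 _ rfl) (fun m hm => h2 _ _ rfl hm)]
    · rfl
    · intro m hm
      have hm' : (j : ℕ) + 1 < m := hm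
      have := h3 ⟨m - 1, by have := m.2; omega⟩ (by simp; omega)
      rw [← this]
      congr 1
      apply Fin.ext
      simp; omega

lemma memW_iff (X : Matrix (Fin (n + 1)) (Fin (n + 1)) F) :
    memW X ↔ (∀ i : Fin n, X i.castSucc i.succ = 1) ∧
      ∀ i j : Fin n, i < j → X i.castSucc j.succ = 0 := by
  constructor
  · intro h
    refine ⟨fun i => (h _ _).1 (by simp), fun i j hij => (h _ _).2 ?_⟩
    have : (i : ℕ) < j := hij
    simpa using this
  · rintro ⟨h1, h2⟩ i j
    refine ⟨fun hij => ?_, fun hij => ?_⟩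
    · have hi : (i : ℕ) < n := by have := j.2; omega
      have := h1 ⟨i, hi⟩
      rw [← this]; congr 1; exact Fin.ext (by simpa using hij)
    · have hi : (i : ℕ) < n := by have := j.2; omega
      have := h2 ⟨i, hi⟩ ⟨j - 1, by have := j.2; omega⟩ (by
        show (i : ℕ) < j - 1
        omega)
      rw [← this]; congr 1; exact Fin.ext (by simp; omega)

lemma memW_iff_delta (X : Matrix (Fin (n + 1)) (Fin (n + 1)) F) :
    memW X ↔ IsLowerUni (deltaPlus X) := by
  rw [memW_iff]
  constructor
  · rintro ⟨h1, h2⟩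
    have key : ∀ k : ℕ, ∀ i j : Fin n, n - 1 - (j : ℕ) = k → i ≤ j →
        deltaPlus X i j = X i.castSucc j.succ := by
      intro k
      induction k using Nat.strong_induction_on with
      | _ k ih =>
        intro i j hk hij
        refine delta_key X i j (fun m hm => ?_) (fun m p hp hmp => ?_)
          (fun m hm => h2 i m (lt_of_le_of_lt hij hm))
        · rw [ih (n - 1 - (m : ℕ)) (by have := m.2; omega) m m rfl le_rfl, h1]
        · rw [ih (n - 1 - (p : ℕ)) (by have := p.2; omega) m p rfl hmp.le, h2 m p hmp]
    refine ⟨fun i => ?_, fun i j hij => ?_⟩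
    · rw [key _ i i rfl le_rfl, h1]
    · rw [key _ i j rfl hij.le, h2 i j hij]
  · rintro ⟨h1, h2⟩
    have key : ∀ k : ℕ, ∀ i j : Fin n, n - 1 - (j : ℕ) = k → i ≤ j →
        deltaPlus X i j = X i.castSucc j.succ := by
      intro k
      induction k using Nat.strong_induction_on with
      | _ k ih =>
        intro i j hk hij
        refine delta_key X i j (fun m _ => h1 m) (fun m p _ hmp => h2 m p hmp)
          (fun m hm => ?_)
        have hlt : i < m := lt_of_le_of_lt hij hm
        rw [← ih (n - 1 - (m : ℕ)) (by have := m.2; omega) i m rfl hlt.le, h2 i m hlt]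
    refine ⟨fun i => ?_, fun i j hij => ?_⟩
    · rw [← key _ i i rfl le_rfl, h1]
    · rw [← key _ i j rfl hij.le, h2 i j hij]

lemma blockA_act (h : Matrix.GeneralLinearGroup (Fin n) F)
    (X : Matrix (Fin (n + 1)) (Fin (n + 1)) F) :
    blockA (act h X) = (h : Matrix (Fin n) (Fin n) F) * blockA X *
      ((h⁻¹ : Matrix.GeneralLinearGroup (Fin n) F) : Matrix (Fin n) (Fin n) F) := by
  ext i j
  simp only [blockA, act, Matrix.of_apply, Matrix.mul_apply, Fin.sum_univ_castSucc, emb_cc, emb_cl,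
    emb_lc, zero_mul, mul_zero, add_zero]

lemma blockU_act (h : Matrix.GeneralLinearGroup (Fin n) F)
    (X : Matrix (Fin (n + 1)) (Fin (n + 1)) F) :
    blockU (act h X) = (h : Matrix (Fin n) (Fin n) F) *ᵥ blockU X := by
  ext i
  simp only [blockU, act, Matrix.mul_apply, Fin.sum_univ_castSucc, emb_cc, emb_cl,
    emb_ll, zero_mul, mul_zero, add_zero, mul_one, Finset.sum_const_zero, zero_add,
    Matrix.mulVec, dotProduct]

lemma pow_act (h : Matrix.GeneralLinearGroup (Fin n) F)
    (X : Matrix (Fin (n + 1)) (Fin (n + 1)) F) (k : ℕ) :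
    blockA (act h X) ^ k *ᵥ blockU (act h X) =
      (h : Matrix (Fin n) (Fin n) F) *ᵥ (blockA X ^ k *ᵥ blockU X) := by
  induction k with
  | zero => simp [blockU_act]
  | succ k ih =>
    rw [pow_succ', ← Matrix.mulVec_mulVec, ih, blockA_act, Matrix.mulVec_mulVec,
      Matrix.mul_assoc, Units.inv_mul, Matrix.mul_one, ← Matrix.mulVec_mulVec, pow_succ',
      ← Matrix.mulVec_mulVec]

lemma delta_act (h : Matrix.GeneralLinearGroup (Fin n) F)
    (X : Matrix (Fin (n + 1)) (Fin (n + 1)) F) :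
    deltaPlus (act h X) = (h : Matrix (Fin n) (Fin n) F) * deltaPlus X := by
  ext i j
  simp only [deltaPlus, Matrix.of_apply, pow_act]
  rfl

lemma memW_sect (a : Fin n → F) (b : Fin (n + 1) → F) : memW (sectSigma' a b) := by
  rw [memW_iff]
  refine ⟨fun i => ?_, fun i j hij => ?_⟩
  · have := i.2
    by_cases h : (i : ℕ) < n - 1
    · simp [sectSigma', h]
    · have e : (i : ℕ) = n - 1 := by omega
      have e2 : ¬ (i : ℕ) + 1 < n := by omega
      simp only [sectSigma', Matrix.of_apply, Fin.val_castSucc, Fin.val_succ]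
      rw [if_neg h, if_pos e, dif_neg e2]
  · have h1 : (i : ℕ) < j := hij
    have h2 : (i : ℕ) < n - 1 := by have := j.2; omega
    have h3 : (j : ℕ) ≠ i := by omega
    simp [sectSigma', h2, h3]

end ZhangRTF

open ZhangRTF

/-- Lemma on `𝒲`, part 1: `X ∈ 𝒲` iff `δ₊(X) ∈ N_{n,-}`; every `X ∈ 𝒲` has
`Δ₊(X) ≠ 0`; and in the decomposition `X = h·σ'(a,b)` of an element of `𝒲` one has
`h ∈ N_{n,-}`, while conversely `u·σ'(a,b) ∈ 𝒲` for `u ∈ N_{n,-}`. -/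
theorem W_characterization (n : ℕ) (hn : 1 ≤ n) (F : Type*) [Field F] :
    (∀ X : Matrix (Fin (n + 1)) (Fin (n + 1)) F, memW X ↔ IsLowerUni (deltaPlus X)) ∧
    (∀ X : Matrix (Fin (n + 1)) (Fin (n + 1)) F, memW X → DeltaPlus X ≠ 0) ∧
    (∀ (X : Matrix (Fin (n + 1)) (Fin (n + 1)) F)
      (h : Matrix.GeneralLinearGroup (Fin n) F) (a : Fin n → F) (b : Fin (n + 1) → F),
        memW X → act h (sectSigma' a b) = X →
          IsLowerUni (h : Matrix (Fin n) (Fin n) F)) ∧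
    (∀ (u : Matrix.GeneralLinearGroup (Fin n) F) (a : Fin n → F) (b : Fin (n + 1) → F),
        IsLowerUni (u : Matrix (Fin n) (Fin n) F) → memW (act u (sectSigma' a b))) := by
  refine ⟨fun X => memW_iff_delta X, fun X hX => ?_, fun X h a b hX hact => ?_, fun u a b hu => ?_⟩
  · have hL := (memW_iff_delta X).1 hX
    have hd : (deltaPlus X).det = 1 := by
      rw [Matrix.det_of_lowerTriangular (deltaPlus X) (fun i j hij => hL.2 i j hij)]
      simp [hL.1]
    unfold DeltaPlus
    rw [hd]
    exact one_ne_zero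
  · subst hact
    have hD := (memW_iff_delta _).1 hX
    rw [delta_act] at hD
    exact lower_of_mul _ _ hD ((memW_iff_delta _).1 (memW_sect a b))
  · rw [memW_iff_delta, delta_act]
    exact lower_mul _ _ hu ((memW_iff_delta _).1 (memW_sect a b))
end
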